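/- Let Φ(u,v,w) = (v + uw + w², (u+w)/√2, log w) for w > 0 and v + uw + w² > 0, and let J⁻¹ = [[0, √2, −w], [1, −√2 w, −(u+w)w], [0, 0, w]] (the Jacobian matrix ∂(u,v,w)/∂(z¹,z²,z³) of the inverse change of coordinates, expressed in terms of (u,v,w)). Then: (a) (J⁻¹) η (J⁻¹)ᵀ = [[2, −3w, 0], [−3w, −2uw, w], [0, w, 0]], and (b) (J⁻¹) G(Φ(u,v,w)) (J⁻¹)ᵀ = [[2v − ½u², 0, ½uw], [0, 0, vw], [½uw, vw, (3/2)w²]], where G(z) is the matrix of the intersection form [[4z¹e^{2z³} + 2√2 z¹z² e^{z³}, (3/√2) z¹ e^{z³}, z¹ + √2 z² e^{z³} + e^{2z³}], [(3/√2) z¹ e^{z³}, z¹ − ½(z²)², e^{z³}/√2 + ½z²], [z¹ + √2 z² e^{z³} + e^{2z³}, e^{z³}/√2 + ½z², 3/2]]. In other words, in the coordinates (u,v,w) the flat pencil (η,g) of M coincides with the leading-order metrics of the bihamiltonian structure of the (2,1)-type rational reduction of the 2D-Toda hierarchy. -/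

import Mathlib

open Matrix

/-- The explicit matrix of the intersection form of M in the flat coordinates z. -/
noncomputable def Gmat (x y z : ℝ) : Matrix (Fin 3) (Fin 3) ℝ :=
  !![4*x*Real.exp (2*z) + 2*Real.sqrt 2*x*y*Real.exp z,
       3/Real.sqrt 2 * x * Real.exp z,
       x + Real.sqrt 2*y*Real.exp z + Real.exp (2*z);
     3/Real.sqrt 2 * x * Real.exp z,
       x - (1/2)*y^2,
       Real.exp z/Real.sqrt 2 + (1/2)*y;
     x + Real.sqrt 2*y*Real.exp z + Real.exp (2*z),
       Real.exp z/Real.sqrt 2 + (1/2)*y,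
       3/2]

/-- The matrix of η in the flat coordinates z (η_{αβ} = 1 iff α+β = 4). -/
noncomputable def etaM : Matrix (Fin 3) (Fin 3) ℝ := !![0,0,1; 0,1,0; 1,0,0]

/-- The Jacobian ∂(u,v,w)/∂(z¹,z²,z³) of the inverse coordinate change. -/
noncomputable def Jinv (u v w : ℝ) : Matrix (Fin 3) (Fin 3) ℝ :=
  !![0, Real.sqrt 2, -w;
     1, -Real.sqrt 2 * w, -(u+w)*w;
     0, 0, w]

/-- in the (u,v,w) coordinates the flat pencil (η, g) of M coincides with
the leading-order metrics of the bihamiltonian structure of the (2,1)-type RR2T. -/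
theorem flat_pencil_in_uvw (u v w : ℝ) (hw : 0 < w) (hd : 0 < v + u*w + w^2) :
    Jinv u v w * etaM * (Jinv u v w)ᵀ
      = !![2, -3*w, 0; -3*w, -2*u*w, w; 0, w, 0]
    ∧ Jinv u v w * Gmat (v + u*w + w^2) ((u+w)/Real.sqrt 2) (Real.log w) * (Jinv u v w)ᵀ
      = !![2*v - (1/2)*u^2, 0, (1/2)*u*w;
           0, 0, v*w;
           (1/2)*u*w, v*w, (3/2)*w^2] := by
  have hs : Real.sqrt 2 ^ 2 = 2 := Real.sq_sqrt zero_le_two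
  have hinv (a : ℝ) : a / Real.sqrt 2 = a * Real.sqrt 2 / 2 := by
    rw [div_eq_div_iff (by positivity) two_ne_zero]
    linear_combination -a * hs
  have he : Real.exp (Real.log w) = w := Real.exp_log hw
  have he2 : Real.exp (2 * Real.log w) = w ^ 2 := by
    rw [two_mul, Real.exp_add, he, sq]
  unfold Jinv etaM Gmat
  simp only [hinv, he, he2]
  generalize Real.sqrt 2 = s at hs
  constructor <;> ext i j <;> fin_cases i <;> fin_cases j <;>
    simp [Matrix.mul_apply, Fin.sum_univ_three] <;> grind
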